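/- arXiv:0812.4003 — 4 statements merged into one kernel-verified Lean document; each statement's English description precedes it below -/
import Mathlib

section
/- Let q : ℝ×ℝ → ℝ be three times continuously differentiable with respect to x and once with respect to t, let λ ∈ ℂ, and let u : ℝ×ℝ → ℂ be sufficiently smooth (all appearing partial derivatives exist and mixed partials commute). If -u_xx + q u = λ u on ℝ×ℝ, then (L_q - λ)(u_t - P_q u) = -(q_t + q_xxx - 6 q q_x) u pointwise. -/
/-- Partial derivative with respect to the first (spatial) variable. -/
noncomputable def pdx {E : Type*} [NormedAddCommGroup E] [NormedSpace ℝ E]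
    (u : ℝ → ℝ → E) : ℝ → ℝ → E :=
  fun x t => deriv (fun x' => u x' t) x

/-- Partial derivative with respect to the second (time) variable. -/
noncomputable def pdt {E : Type*} [NormedAddCommGroup E] [NormedSpace ℝ E]
    (u : ℝ → ℝ → E) : ℝ → ℝ → E :=
  fun x t => deriv (fun t' => u x t') t

/-- The Schrödinger (Lax) operator `L_q u = -u_xx + q u`. -/
noncomputable def Lop (q : ℝ → ℝ → ℝ) (u : ℝ → ℝ → ℂ) : ℝ → ℝ → ℂ :=
  fun x t => -(pdx (pdx u) x t) + (q x t : ℂ) * u x t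

/-- The second Lax operator `P_q u = -4 u_xxx + 6 q u_x + 3 q_x u`. -/
noncomputable def Pop (q : ℝ → ℝ → ℝ) (u : ℝ → ℝ → ℂ) : ℝ → ℝ → ℂ :=
  fun x t => -4 * pdx (pdx (pdx u)) x t + 6 * (q x t : ℂ) * pdx u x t
    + 3 * ((pdx q x t : ℝ) : ℂ) * u x t

/-- The KdV equation `q_t = -q_xxx + 6 q q_x`. -/
def KdV (q : ℝ → ℝ → ℝ) : Prop :=
  ∀ x t, pdt q x t = -(pdx (pdx (pdx q)) x t) + 6 * q x t * pdx q x t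


section PartialDerivatives

variable {E : Type*} [NormedAddCommGroup E] [NormedSpace ℝ E]

theorem hasDerivAt_fst_of_differentiable {u : ℝ → ℝ → E}
    (hu : Differentiable ℝ fun p : ℝ × ℝ => u p.1 p.2) (x t : ℝ) :
    HasDerivAt (fun x' => u x' t) (fderiv ℝ (fun p : ℝ × ℝ => u p.1 p.2) (x, t) (1, 0)) x :=
  HasFDerivAt.comp_hasDerivAt (l := fun p : ℝ × ℝ => u p.1 p.2) (f := fun x' => (x', t)) x
    (hu (x, t)).hasFDerivAt ((hasDerivAt_id x).prodMk (hasDerivAt_const x t))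

theorem hasDerivAt_snd_of_differentiable {u : ℝ → ℝ → E}
    (hu : Differentiable ℝ fun p : ℝ × ℝ => u p.1 p.2) (x t : ℝ) :
    HasDerivAt (fun t' => u x t') (fderiv ℝ (fun p : ℝ × ℝ => u p.1 p.2) (x, t) (0, 1)) t :=
  HasFDerivAt.comp_hasDerivAt (l := fun p : ℝ × ℝ => u p.1 p.2) (f := fun t' => (x, t')) t
    (hu (x, t)).hasFDerivAt ((hasDerivAt_const t x).prodMk (hasDerivAt_id t))

theorem pdx_eq_fderiv {u : ℝ → ℝ → E} (hu : Differentiable ℝ fun p : ℝ × ℝ => u p.1 p.2) :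
    pdx u = fun x t => fderiv ℝ (fun p : ℝ × ℝ => u p.1 p.2) (x, t) (1, 0) :=
  funext₂ fun x t => (hasDerivAt_fst_of_differentiable hu x t).deriv

theorem pdt_eq_fderiv {u : ℝ → ℝ → E} (hu : Differentiable ℝ fun p : ℝ × ℝ => u p.1 p.2) :
    pdt u = fun x t => fderiv ℝ (fun p : ℝ × ℝ => u p.1 p.2) (x, t) (0, 1) :=
  funext₂ fun x t => (hasDerivAt_snd_of_differentiable hu x t).deriv

theorem hasDerivAt_pdx {u : ℝ → ℝ → E} (hu : Differentiable ℝ fun p : ℝ × ℝ => u p.1 p.2)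
    (x t : ℝ) : HasDerivAt (fun x' => u x' t) (pdx u x t) x :=
  (hasDerivAt_fst_of_differentiable hu x t).differentiableAt.hasDerivAt

theorem hasDerivAt_pdt {u : ℝ → ℝ → E} (hu : Differentiable ℝ fun p : ℝ × ℝ => u p.1 p.2)
    (x t : ℝ) : HasDerivAt (fun t' => u x t') (pdt u x t) t :=
  (hasDerivAt_snd_of_differentiable hu x t).differentiableAt.hasDerivAt

theorem ContDiff.differentiable_of_smooth {F : ℝ × ℝ → E} (hF : ContDiff ℝ (⊤ : ℕ∞) F) :
    Differentiable ℝ F :=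
  hF.differentiable (by simp)

theorem contDiff_pdx {u : ℝ → ℝ → E} (hu : ContDiff ℝ (⊤ : ℕ∞) fun p : ℝ × ℝ => u p.1 p.2) :
    ContDiff ℝ (⊤ : ℕ∞) fun p : ℝ × ℝ => pdx u p.1 p.2 := by
  rw [pdx_eq_fderiv hu.differentiable_of_smooth]
  exact (hu.fderiv_right (by simp)).clm_apply contDiff_const

theorem contDiff_pdt {u : ℝ → ℝ → E} (hu : ContDiff ℝ (⊤ : ℕ∞) fun p : ℝ × ℝ => u p.1 p.2) :
    ContDiff ℝ (⊤ : ℕ∞) fun p : ℝ × ℝ => pdt u p.1 p.2 := by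
  rw [pdt_eq_fderiv hu.differentiable_of_smooth]
  exact (hu.fderiv_right (by simp)).clm_apply contDiff_const

/-- Mixed partial derivatives of a smooth function commute. -/
theorem pdx_pdt_comm {u : ℝ → ℝ → E} (hu : ContDiff ℝ (⊤ : ℕ∞) fun p : ℝ × ℝ => u p.1 p.2) :
    pdx (pdt u) = pdt (pdx u) := by
  have hd : Differentiable ℝ (fderiv ℝ fun p : ℝ × ℝ => u p.1 p.2) :=
    ContDiff.differentiable_of_smooth (F := fderiv ℝ fun p : ℝ × ℝ => u p.1 p.2)
      (hu.fderiv_right (by simp))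
  have key (v w p : ℝ × ℝ) :
      fderiv ℝ (fun p => fderiv ℝ (fun p : ℝ × ℝ => u p.1 p.2) p v) p w
        = fderiv ℝ (fderiv ℝ fun p : ℝ × ℝ => u p.1 p.2) p w v := by
    rw [fderiv_clm_apply (hd p) (differentiableAt_const v)]
    simp
  rw [pdx_eq_fderiv (contDiff_pdt hu).differentiable_of_smooth,
    pdt_eq_fderiv (contDiff_pdx hu).differentiable_of_smooth,
    pdx_eq_fderiv hu.differentiable_of_smooth, pdt_eq_fderiv hu.differentiable_of_smooth]
  funext x t
  simp only [Prod.mk.eta]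
  rw [key, key]
  exact (hu.contDiffAt.isSymmSndFDerivAt
    (by simpa using WithTop.coe_le_coe.2 (le_top (a := (2 : ℕ∞))))).eq _ _

end PartialDerivatives

/-- A `C³` function has three successive derivatives in the spatial variable. -/
theorem hasDerivAt_pdx_of_contDiff_three {q : ℝ → ℝ → ℝ}
    (hq : ∀ t, ContDiff ℝ 3 fun x => q x t) (x t : ℝ) :
    HasDerivAt (fun x => q x t) (pdx q x t) x ∧
      HasDerivAt (fun x => pdx q x t) (pdx (pdx q) x t) x ∧
        HasDerivAt (fun x => pdx (pdx q) x t) (pdx (pdx (pdx q)) x t) x := by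
  have h1 : ContDiff ℝ 2 fun x => pdx q x t :=
    ((contDiff_succ_iff_deriv (n := 2)).1 (by exact_mod_cast hq t)).2.2
  have h2 : ContDiff ℝ 1 fun x => pdx (pdx q) x t :=
    ((contDiff_succ_iff_deriv (n := 1)).1 (by exact_mod_cast h1)).2.2
  exact ⟨((hq t).differentiable (by simp) x).hasDerivAt,
    (h1.differentiable (by simp) x).hasDerivAt, (h2.differentiable (by simp) x).hasDerivAt⟩

theorem pdx_pdx_eq_of_hasDerivAt {f g h : ℝ → ℝ → ℂ}
    (hf : ∀ x t, HasDerivAt (fun x => f x t) (g x t) x)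
    (hg : ∀ x t, HasDerivAt (fun x => g x t) (h x t) x) : pdx (pdx f) = h := by
  have hfg : pdx f = g := funext₂ fun x t => (hf x t).deriv
  rw [hfg]
  exact funext₂ fun x t => (hg x t).deriv

theorem statement1 (q : ℝ → ℝ → ℝ) (lam : ℂ) (u : ℝ → ℝ → ℂ)
    (hqx : ∀ t, ContDiff ℝ 3 fun x => q x t)
    (hqt : ∀ x, ContDiff ℝ 1 fun t => q x t)
    (hu : ContDiff ℝ (⊤ : ℕ∞) fun p : ℝ × ℝ => u p.1 p.2)
    (heq : ∀ x t, -(pdx (pdx u) x t) + (q x t : ℂ) * u x t = lam * u x t) :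
    ∀ x t,
      Lop q (fun x t => pdt u x t - Pop q u x t) x t
          - lam * (pdt u x t - Pop q u x t)
        = -(((pdt q x t + pdx (pdx (pdx q)) x t - 6 * q x t * pdx q x t : ℝ) : ℂ)) * u x t := by
  have hu1 := contDiff_pdx hu
  have du := hasDerivAt_pdx hu.differentiable_of_smooth
  have huxx : pdx (pdx u) = fun x t => ((q x t : ℂ) - lam) * u x t :=
    funext₂ fun x t => by linear_combination -heq x t
  have dux (x t : ℝ) : HasDerivAt (fun x => pdx u x t) (((q x t : ℂ) - lam) * u x t) x := by
    have h := hasDerivAt_pdx hu1.differentiable_of_smooth x t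
    rwa [huxx] at h
  have dq (x t : ℝ) := (hasDerivAt_pdx_of_contDiff_three hqx x t).1.ofReal_comp
  have dq1 (x t : ℝ) := (hasDerivAt_pdx_of_contDiff_three hqx x t).2.1.ofReal_comp
  have dq2 (x t : ℝ) := (hasDerivAt_pdx_of_contDiff_three hqx x t).2.2.ofReal_comp
  have huxxx : pdx (pdx (pdx u)) = fun x t =>
      ((pdx q x t : ℝ) : ℂ) * u x t + ((q x t : ℂ) - lam) * pdx u x t := by
    rw [huxx]
    exact funext₂ fun x t => (((dq x t).sub_const lam).mul (du x t)).deriv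
  have hP (x t : ℝ) : Pop q u x t
      = -((pdx q x t : ℝ) : ℂ) * u x t + (2 * (q x t : ℂ) + 4 * lam) * pdx u x t := by
    simp only [Pop, huxxx]
    ring
  have hut := contDiff_pdt hu
  have dut := hasDerivAt_pdx hut.differentiable_of_smooth
  have dutx := hasDerivAt_pdx (contDiff_pdx hut).differentiable_of_smooth
  have hutxx : pdx (pdx (pdt u)) = fun x t =>
      ((pdt q x t : ℝ) : ℂ) * u x t + ((q x t : ℂ) - lam) * pdt u x t := by
    rw [pdx_pdt_comm hu, pdx_pdt_comm hu1, huxx]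
    refine funext₂ fun x t => HasDerivAt.deriv ?_
    have hq : HasDerivAt (fun t => q x t) (pdt q x t) t :=
      ((hqt x).differentiable (by simp) t).hasDerivAt
    exact (hq.ofReal_comp.sub_const lam).mul (hasDerivAt_pdt hu.differentiable_of_smooth x t)
  have hw : pdx (pdx fun x t => pdt u x t - Pop q u x t) = fun x t =>
      pdx (pdx (pdt u)) x t
        - ((-((pdx (pdx (pdx q)) x t : ℝ) : ℂ) + 2 * ((pdx q x t : ℝ) : ℂ) * ((q x t : ℂ) - lam)
              + (2 * (q x t : ℂ) + 4 * lam) * ((pdx q x t : ℝ) : ℂ)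
              + ((pdx q x t : ℝ) : ℂ) * ((q x t : ℂ) - lam)) * u x t
            + (2 * (q x t : ℂ) + 4 * lam) * ((q x t : ℂ) - lam) * pdx u x t) := by
    simp only [hP]
    refine pdx_pdx_eq_of_hasDerivAt (g := fun x t => pdx (pdt u) x t
        - ((-((pdx (pdx q) x t : ℝ) : ℂ) + (2 * (q x t : ℂ) + 4 * lam) * ((q x t : ℂ) - lam)) * u x t
            + ((pdx q x t : ℝ) : ℂ) * pdx u x t)) (fun x t => ?_) (fun x t => ?_)
    · have hc := ((dq x t).const_mul 2).add_const (4 * lam)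
      refine ((dut x t).sub (((dq1 x t).neg.mul (du x t)).add (hc.mul (dux x t)))).congr_deriv ?_
      simp only [Pi.neg_apply]
      ring
    · have hc := ((dq x t).const_mul 2).add_const (4 * lam)
      refine ((dutx x t).sub ((((dq2 x t).neg.add (hc.mul ((dq x t).sub_const lam))).mul
        (du x t)).add ((dq1 x t).mul (dux x t)))).congr_deriv ?_
      simp only [Pi.neg_apply, Pi.add_apply, Pi.mul_apply]
      ring
  intro x t
  simp only [Lop]
  rw [hw, hutxx, hP]
  push_cast
  ring
end

section
/- Let q : ℝ×ℝ → ℝ be three times continuously differentiable in x, let λ ∈ ℂ, and let u : ℝ×ℝ → ℂ be sufficiently smooth in x. If -u_xx + q u = λ u, then (L_q - λ)(P_q u) = (q_xxx - 6 q q_x) u pointwise. -/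
theorem hasDerivAt_pdx_s3 {E : Type*} [NormedAddCommGroup E] [NormedSpace ℝ E] {f : ℝ → ℝ → E}
    {t : ℝ} {n : WithTop ℕ∞} (hf : ContDiff ℝ n fun x => f x t) (hn : n ≠ 0) (x : ℝ) :
    HasDerivAt (fun x => f x t) (pdx f x t) x :=
  (hf.differentiable hn x).hasDerivAt

theorem contDiff_pdx_s3 {E : Type*} [NormedAddCommGroup E] [NormedSpace ℝ E] {f : ℝ → ℝ → E}
    {t : ℝ} {n : WithTop ℕ∞} (hf : ContDiff ℝ (n + 1) fun x => f x t) :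
    ContDiff ℝ n fun x => pdx f x t :=
  hf.deriv'

theorem pdx_eq_of_hasDerivAt {E : Type*} [NormedAddCommGroup E] [NormedSpace ℝ E]
    {f : ℝ → ℝ → E} {x t : ℝ} {f' : E} (h : HasDerivAt (fun x => f x t) f' x) :
    pdx f x t = f' :=
  h.deriv

theorem statement3 (q : ℝ → ℝ → ℝ) (lam : ℂ) (u : ℝ → ℝ → ℂ)
    (hq : ∀ t, ContDiff ℝ 3 fun x => q x t)
    (hu : ∀ t, ContDiff ℝ (⊤ : ℕ∞) fun x => u x t)
    (heq : ∀ x t, -(pdx (pdx u) x t) + (q x t : ℂ) * u x t = lam * u x t) :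
    ∀ x t, Lop q (Pop q u) x t - lam * Pop q u x t
      = ((pdx (pdx (pdx q)) x t - 6 * q x t * pdx q x t : ℝ) : ℂ) * u x t := by
  have hq1 (x t : ℝ) : HasDerivAt (fun x => (q x t : ℂ)) ((pdx q x t : ℝ) : ℂ) x :=
    (hasDerivAt_pdx_s3 (hq t) (by norm_num) x).ofReal_comp
  have cq1 (t : ℝ) : ContDiff ℝ 2 fun x => pdx q x t := contDiff_pdx_s3 (hq t)
  have hq2 (x t : ℝ) :
      HasDerivAt (fun x => ((pdx q x t : ℝ) : ℂ)) ((pdx (pdx q) x t : ℝ) : ℂ) x :=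
    (hasDerivAt_pdx_s3 (cq1 t) (by norm_num) x).ofReal_comp
  have cq2 (t : ℝ) : ContDiff ℝ 1 fun x => pdx (pdx q) x t := contDiff_pdx_s3 (cq1 t)
  have hq3 (x t : ℝ) :
      HasDerivAt (fun x => ((pdx (pdx q) x t : ℝ) : ℂ)) ((pdx (pdx (pdx q)) x t : ℝ) : ℂ) x :=
    (hasDerivAt_pdx_s3 (cq2 t) (by norm_num) x).ofReal_comp
  have hu1 (x t : ℝ) : HasDerivAt (fun x => u x t) (pdx u x t) x :=
    hasDerivAt_pdx_s3 (hu t) (by simp) x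
  have hu_xx (x t : ℝ) : pdx (pdx u) x t = ((q x t : ℂ) - lam) * u x t := by
    linear_combination -heq x t
  have hu2 (x t : ℝ) : HasDerivAt (fun x => pdx u x t) (((q x t : ℂ) - lam) * u x t) x := by
    rw [← hu_xx]
    exact hasDerivAt_pdx_s3 (contDiff_pdx_s3 (n := (⊤ : ℕ∞)) (hu t)) (by simp) x
  have hu_xxx (x t : ℝ) : pdx (pdx (pdx u)) x t
      = ((pdx q x t : ℝ) : ℂ) * u x t + ((q x t : ℂ) - lam) * pdx u x t := by
    apply pdx_eq_of_hasDerivAt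
    simp only [hu_xx]
    exact ((hq1 x t).sub_const lam).mul (hu1 x t)
  have hP (x t : ℝ) : Pop q u x t
      = (2 * (q x t : ℂ) + 4 * lam) * pdx u x t - ((pdx q x t : ℝ) : ℂ) * u x t := by
    rw [Pop, hu_xxx]
    ring
  have hP_x (x t : ℝ) : pdx (Pop q u) x t
      = ((pdx q x t : ℝ) : ℂ) * pdx u x t - ((pdx (pdx q) x t : ℝ) : ℂ) * u x t
        + (2 * (q x t : ℂ) + 4 * lam) * (((q x t : ℂ) - lam) * u x t) := by
    apply pdx_eq_of_hasDerivAt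
    simp only [hP]
    refine (((((hq1 x t).const_mul 2).add_const (4 * lam)).mul (hu2 x t)).sub
      ((hq2 x t).mul (hu1 x t))).congr_deriv ?_
    ring
  have hP_xx (x t : ℝ) : pdx (pdx (Pop q u)) x t
      = ((pdx q x t : ℝ) : ℂ) * (((q x t : ℂ) - lam) * u x t)
        - ((pdx (pdx (pdx q)) x t : ℝ) : ℂ) * u x t
        + 2 * ((pdx q x t : ℝ) : ℂ) * (((q x t : ℂ) - lam) * u x t)
        + (2 * (q x t : ℂ) + 4 * lam)
          * (((pdx q x t : ℝ) : ℂ) * u x t + ((q x t : ℂ) - lam) * pdx u x t) := by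
    apply pdx_eq_of_hasDerivAt
    simp only [hP_x]
    refine ((((hq2 x t).mul (hu2 x t)).sub ((hq3 x t).mul (hu1 x t))).add
      ((((hq1 x t).const_mul 2).add_const (4 * lam)).mul
        (((hq1 x t).sub_const lam).mul (hu1 x t)))).congr_deriv ?_
    simp only [Pi.mul_apply]
    ring
  intro x t
  rw [Lop, hP_xx, hP]
  push_cast
  ring
end

section
/- Let q : ℝ×ℝ → ℝ be sufficiently smooth, λ ∈ ℂ, β : ℝ → ℂ, and let u : ℝ×ℝ → ℂ be sufficiently smooth with -u_xx + q u = λ u, u_t - P_q u = β(t) u on ℝ×ℝ, and with the normalization u(0,t) = 1 for all t. Then β(t) = q_x(0,t) - 2 (q(0,t) + 2λ) u_x(0,t) for every t. -/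
theorem statement8 (q : ℝ → ℝ → ℝ) (lam : ℂ) (β : ℝ → ℂ) (u : ℝ → ℝ → ℂ)
    (hq : ContDiff ℝ (⊤ : ℕ∞) fun p : ℝ × ℝ => q p.1 p.2)
    (hu : ContDiff ℝ (⊤ : ℕ∞) fun p : ℝ × ℝ => u p.1 p.2)
    (heq : ∀ x t, Lop q u x t = lam * u x t)
    (ht : ∀ x t, pdt u x t - Pop q u x t = β t * u x t)
    (hnorm : ∀ t, u 0 t = 1) :
    ∀ t, β t = ((pdx q 0 t : ℝ) : ℂ) - 2 * ((q 0 t : ℂ) + 2 * lam) * pdx u 0 t := by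
  intro t
  have hpair : ContDiff ℝ (⊤ : ℕ∞) fun x : ℝ => (x, t) := contDiff_id.prodMk contDiff_const
  have hqx : HasDerivAt (fun x => q x t) (pdx q 0 t) 0 :=
    ((hq.comp hpair).differentiable (by simp) 0).hasDerivAt
  have hux : HasDerivAt (fun x => u x t) (pdx u 0 t) 0 :=
    ((hu.comp hpair).differentiable (by simp) 0).hasDerivAt
  have huxx : (fun x => pdx (pdx u) x t) = fun x => ((q x t : ℂ) - lam) * u x t := by
    funext x
    have h := heq x t
    unfold Lop at h
    linear_combination -h
  have huxxx : pdx (pdx (pdx u)) 0 t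
      = ((pdx q 0 t : ℝ) : ℂ) * u 0 t + ((q 0 t : ℂ) - lam) * pdx u 0 t := by
    have h : pdx (pdx (pdx u)) 0 t = deriv (fun x => pdx (pdx u) x t) 0 := rfl
    rw [h, huxx]
    exact ((hqx.ofReal_comp.sub_const lam).mul hux).deriv
  have hut : pdt u 0 t = 0 := by simp [pdt, hnorm]
  have h := ht 0 t
  rw [hut, Pop, huxxx, hnorm] at h
  linear_combination -h
end

section
/- Let q : ℝ → ℝ be continuous, λ ∈ ℝ, and let u, v : ℝ → ℂ be C² solutions of -y'' + q y = λ y with W(v,u) ≠ 0. Define T₊ = W(ū,u)/W(v,u), R₊ = -W(v,ū)/W(v,u), and R₋ = -W(u,v̄)/W(u,v). Then conj(R₊) · T₊ + R₋ · conj(T₊) = 0. (This is property I(d) of the scattering data on the spectrum of multiplicity two.) -/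
/-- The Wronskian `W(f,g) = f g' - f' g`. -/
noncomputable def Wr (f g : ℝ → ℂ) (x : ℝ) : ℂ := f x * deriv g x - deriv f x * g x

/-- Pointwise complex conjugate of a function. -/
def cconj (f : ℝ → ℂ) : ℝ → ℂ := fun x => (starRingEnd ℂ) (f x)

theorem deriv_cconj (f : ℝ → ℂ) (x : ℝ) :
    deriv (cconj f) x = (starRingEnd ℂ) (deriv f x) :=
  deriv.star

theorem cconj_cconj (f : ℝ → ℂ) : cconj (cconj f) = f := by
  ext x
  simp [cconj]

theorem conj_Wr (f g : ℝ → ℂ) (x : ℝ) :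
    (starRingEnd ℂ) (Wr f g x) = Wr (cconj f) (cconj g) x := by
  simp [Wr, deriv_cconj, cconj]

theorem Wr_swap (f g : ℝ → ℂ) (x : ℝ) : Wr g f x = -Wr f g x := by
  simp only [Wr]
  ring

theorem statement13 (q : ℝ → ℝ) (hq : Continuous q) (lam : ℝ)
    (u v : ℝ → ℂ) (hu : ContDiff ℝ 2 u) (hv : ContDiff ℝ 2 v)
    (hueq : ∀ x, -(deriv (deriv u) x) + (q x : ℂ) * u x = (lam : ℂ) * u x)
    (hveq : ∀ x, -(deriv (deriv v) x) + (q x : ℂ) * v x = (lam : ℂ) * v x)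
    (hW : Wr v u 0 ≠ 0) :
    (starRingEnd ℂ) (-(Wr v (cconj u) 0 / Wr v u 0)) * (Wr (cconj u) u 0 / Wr v u 0)
      + (-(Wr u (cconj v) 0 / Wr u v 0))
        * (starRingEnd ℂ) (Wr (cconj u) u 0 / Wr v u 0) = 0 := by
  simp only [map_neg, map_div₀, conj_Wr, cconj_cconj]
  rw [Wr_swap v u, Wr_swap (cconj v) u, Wr_swap (cconj u) u]
  ring
end
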